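/- (Theorem 1, converse, quantitative form.) Let λ, T > 0 and 0 < α, β < 1, and set the threshold U = √(λT/α). Suppose Δ > 0 satisfies Δ·T ≥ U + √((λ + Δ)T/β). Consider the detector that rejects H₀ if and only if the observed packet count S satisfies S ≥ λT + U. Then its false alarm probability under the Poisson distribution with mean λT is at most α, and its missed detection probability under the Poisson distribution with mean (λ + Δ)T is at most β. -/

import Mathlib

/-- The Poisson probability mass function with mean `m`: `P(n) = e^{-m} mⁿ / n!`. -/
noncomputable def poissonPMF (m : ℝ) (n : ℕ) : ℝ :=
  Real.exp (-m) * m ^ n / n.factorial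

/-- The probability assigned by a pmf `P` on ℕ to a set `A ⊆ ℕ`. -/
noncomputable def pmfProb (P : ℕ → ℝ) (A : Set ℕ) : ℝ :=
  ∑' n : ℕ, A.indicator P n

theorem poissonPMF_nonneg {m : ℝ} (hm : 0 ≤ m) (n : ℕ) : 0 ≤ poissonPMF m n := by
  unfold poissonPMF
  positivity

theorem succ_mul_poissonPMF_succ (m : ℝ) (n : ℕ) :
    ((n + 1 : ℕ) : ℝ) * poissonPMF m (n + 1) = m * poissonPMF m n := by
  have h : ((n : ℝ) + 1) ≠ 0 := by positivity
  unfold poissonPMF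
  rw [Nat.factorial_succ]
  push_cast
  field_simp
  ring

theorem hasSum_poissonPMF (m : ℝ) : HasSum (poissonPMF m) 1 := by
  have h := (NormedSpace.expSeries_div_hasSum_exp m).mul_left (Real.exp (-m))
  rw [← Real.exp_eq_exp_ℝ, ← Real.exp_add, neg_add_cancel, Real.exp_zero] at h
  simp only [← mul_div_assoc] at h
  exact h

theorem hasSum_natCast_mul_poissonPMF (m : ℝ) :
    HasSum (fun n : ℕ => (n : ℝ) * poissonPMF m n) m := by
  rw [← hasSum_nat_add_iff' 1]
  simp only [succ_mul_poissonPMF_succ]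
  simpa using (hasSum_poissonPMF m).mul_left m

theorem hasSum_natCast_sq_mul_poissonPMF (m : ℝ) :
    HasSum (fun n : ℕ => (n : ℝ) ^ 2 * poissonPMF m n) (m * (m + 1)) := by
  rw [← hasSum_nat_add_iff' 1]
  simp only [pow_two, mul_assoc, succ_mul_poissonPMF_succ]
  have h := ((hasSum_natCast_mul_poissonPMF m).add (hasSum_poissonPMF m)).mul_left m
  convert! h using 1
  · funext n
    push_cast
    ring
  · simp

/-- The variance of the Poisson distribution with mean `m` is `m`. -/
theorem hasSum_sub_sq_mul_poissonPMF (m : ℝ) :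
    HasSum (fun n : ℕ => ((n : ℝ) - m) ^ 2 * poissonPMF m n) m := by
  have h := ((hasSum_natCast_sq_mul_poissonPMF m).sub
    ((hasSum_natCast_mul_poissonPMF m).mul_left (2 * m))).add
    ((hasSum_poissonPMF m).mul_left (m ^ 2))
  convert! h using 1
  · funext n
    ring
  · ring

/-- Chebyshev's inequality for the Poisson distribution. -/
theorem pmfProb_poissonPMF_le {m γ : ℝ} (hm : 0 < m) (hγ : 0 < γ) {A : Set ℕ}
    (hA : ∀ n ∈ A, Real.sqrt (m / γ) ≤ |(n : ℝ) - m|) :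
    pmfProb (poissonPMF m) A ≤ γ := by
  have hsum := (hasSum_sub_sq_mul_poissonPMF m).mul_left (γ / m)
  rw [div_mul_cancel₀ _ hm.ne'] at hsum
  refine hasSum_le (fun n => ?_) ((hasSum_poissonPMF m).summable.indicator A).hasSum hsum
  have hp := poissonPMF_nonneg hm.le n
  by_cases hn : n ∈ A
  · rw [Set.indicator_of_mem hn]
    have hsq : m / γ ≤ ((n : ℝ) - m) ^ 2 := by
      rw [← sq_abs]
      exact (Real.sqrt_le_left (abs_nonneg _)).mp (hA n hn)
    have hone : 1 ≤ γ / m * ((n : ℝ) - m) ^ 2 := by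
      calc (1 : ℝ) = γ / m * (m / γ) := by field_simp
        _ ≤ γ / m * ((n : ℝ) - m) ^ 2 := by gcongr
    rw [← mul_assoc]
    exact le_mul_of_one_le_left hp hone
  · rw [Set.indicator_of_notMem hn]
    positivity

/-- Theorem 1 (converse), quantitative form: with threshold `U = √(λT/α)` and
`ΔT ≥ U + √((λ+Δ)T/β)`, the detector rejecting iff the packet count `S` satisfies
`S ≥ λT + U` has false alarm probability at most `α` under Poisson(λT) and missed
detection probability at most `β` under Poisson((λ+Δ)T). -/
theorem covert_insertion_converse (lam T Δ α β : ℝ) (hlam : 0 < lam) (hT : 0 < T)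
    (hα0 : 0 < α) (hα1 : α < 1) (hβ0 : 0 < β) (hβ1 : β < 1) (hΔ0 : 0 < Δ)
    (hΔ : Δ * T ≥ Real.sqrt (lam * T / α) + Real.sqrt ((lam + Δ) * T / β)) :
    pmfProb (poissonPMF (lam * T))
        {n : ℕ | lam * T + Real.sqrt (lam * T / α) ≤ (n : ℝ)} ≤ α ∧
    pmfProb (poissonPMF ((lam + Δ) * T))
        {n : ℕ | lam * T + Real.sqrt (lam * T / α) ≤ (n : ℝ)}ᶜ ≤ β := by
  refine ⟨pmfProb_poissonPMF_le (by positivity) hα0 fun n hn => ?_,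
    pmfProb_poissonPMF_le (by positivity) hβ0 fun n hn => ?_⟩
  · rw [Set.mem_ofPred_eq] at hn
    exact le_trans (by linarith) (le_abs_self _)
  · rw [Set.mem_compl_iff, Set.mem_ofPred_eq, not_le] at hn
    exact le_trans (by linarith) (neg_le_abs _)
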